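/- Let M be a continuum, C a nonempty set of cut points of M, K the cut point pretree of M dual to C, and (K_α) the transfinite sequence of quotients of K. Then there exists an ordinal α₀ at which the sequence stabilizes (the quotient maps π_{α₀} and π_{α₀+1} from K have the same fibers), and the composite quotient map M → K → K_{α₀} induces a well-defined bijection from the dendrite quotient D(M,C) = M/≈ onto K_{α₀}. -/

import Mathlib

open Set

universe u v w

namespace RelHypBoundary

/-! ### Pretrees -/

variable {K : Type*} {G : Type*}

/-- `btw x y z` means `y` is between `x` and `z`.  The open interval `(x,z)`. -/
def openInt (btw : K → K → K → Prop) (x z : K) : Set K := {y | btw x y z}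

/-- The closed interval `[x,z]`. -/
def closedInt (btw : K → K → K → Prop) (x z : K) : Set K :=
  openInt btw x z ∪ {x, z}

/-- A subset of a pretree is full if it contains the closed interval between
any two of its points. -/
def IsFull (btw : K → K → K → Prop) (A : Set K) : Prop :=
  ∀ x ∈ A, ∀ z ∈ A, closedInt btw x z ⊆ A

/-- The pretree axioms for a ternary betweenness relation `btw x y z`
("`y` is between `x` and `z`"). -/
structure IsPretree (btw : K → K → K → Prop) : Prop where
  ne_of_btw : ∀ {x y z : K}, btw x y z → x ≠ z
  symm : ∀ {x y z : K}, btw x y z → btw z y x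
  asymm : ∀ {x y z : K}, btw x y z → ¬ btw x z y
  split : ∀ {x y z : K} (w : K), btw x y z → y ≠ w → btw x y w ∨ btw w y z

/-- A median pretree: every triple of points has a median. -/
def IsMedianPretree (btw : K → K → K → Prop) : Prop :=
  ∀ x y z : K, ∃ m : K,
    m ∈ closedInt btw x y ∧ m ∈ closedInt btw y z ∧ m ∈ closedInt btw z x

/-- An arc: a nonempty full subset that is linearly ordered by betweenness. -/
def IsArc (btw : K → K → K → Prop) (A : Set K) : Prop :=
  A.Nonempty ∧ IsFull btw A ∧
    ∀ x ∈ A, ∀ y ∈ A, ∀ z ∈ A, x ≠ y → y ≠ z → x ≠ z →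
      btw x y z ∨ btw y z x ∨ btw z x y

/-- `A` is an interval (open, half-open or closed). -/
def IsIntervalSet (btw : K → K → K → Prop) (A : Set K) : Prop :=
  ∃ x z : K, A = openInt btw x z ∨ A = closedInt btw x z ∨
    A = insert x (openInt btw x z) ∨ A = insert z (openInt btw x z)

/-- A pretree is complete if every arc is an interval. -/
def IsCompletePretree (btw : K → K → K → Prop) : Prop :=
  ∀ A : Set K, IsArc btw A → IsIntervalSet btw A

/-- A pretree is interval complete if every arc contained in an interval is an interval. -/
def IsIntervalComplete (btw : K → K → K → Prop) : Prop :=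
  ∀ A : Set K, IsArc btw A → (∃ x z : K, A ⊆ closedInt btw x z) → IsIntervalSet btw A

/-- The interior of a pretree: the set of non-terminal points. -/
def pretreeInterior (btw : K → K → K → Prop) : Set K :=
  {y | ∃ x z : K, btw x y z}

/-- Two points are adjacent if they are distinct and the open interval between
them is empty. -/
def AdjacentP (btw : K → K → K → Prop) (x z : K) : Prop :=
  x ≠ z ∧ ∀ y : K, ¬ btw x y z

/-- A map preserves betweenness. -/
def PreservesBtw (btw : K → K → K → Prop) (f : K → K) : Prop :=
  ∀ x y z : K, btw x y z ↔ btw (f x) (f y) (f z)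

/-- A pretree automorphism: a betweenness-preserving bijection. -/
def IsPretreeAuto (btw : K → K → K → Prop) (e : K ≃ K) : Prop :=
  ∀ x y z : K, btw x y z ↔ btw (e x) (e y) (e z)

/-- A group action (given by `act`) on a pretree is non-nesting if no group
element maps a closed interval properly into itself. -/
def NonNesting (btw : K → K → K → Prop) (act : G → K → K) : Prop :=
  ∀ (g : G) (x z : K), ¬ (act g '' closedInt btw x z ⊂ closedInt btw x z)

/-- Non-nesting for the restricted action on a subpretree `S` (intervals of the
subpretree are intervals of the ambient pretree intersected with `S`). -/
def NonNestingOn (btw : K → K → K → Prop) (S : Set K) (act : G → K → K) : Prop :=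
  ∀ (g : G) (x z : K), x ∈ S → z ∈ S →
    ¬ (act g '' (closedInt btw x z ∩ S) ⊂ closedInt btw x z ∩ S)

/-- `p` is a connector point of the ordered pair `(Y, X)`. -/
def IsConnector (btw : K → K → K → Prop) (Y X : Set K) (p : K) : Prop :=
  p ∈ Y ∧ ∀ x ∈ X, closedInt btw x p ∩ Y = {p}

/-- A full relation: an equivalence relation all of whose classes are full. -/
def IsFullRelation (btw : K → K → K → Prop) (s : Setoid K) : Prop :=
  ∀ x y : K, s.r x y → ∀ z ∈ closedInt btw x y, s.r x z

/-- The induced betweenness on the quotient by a full relation: `Y` lies between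
`X` and `Z` iff some `y₀ ∈ Y` lies between every `x ∈ X` and every `z ∈ Z`. -/
def quotBtw (btw : K → K → K → Prop) (s : Setoid K) :
    Quotient s → Quotient s → Quotient s → Prop := fun X Y Z =>
  ∃ y₀ : K, Quotient.mk s y₀ = Y ∧
    ∀ x z : K, Quotient.mk s x = X → Quotient.mk s z = Z → btw x y₀ z

/-- Quotient betweenness expressed on representatives, for an arbitrary
relation `r`: the class of `y` lies between the class of `x` and the class of
`z`. -/
def qBtw (btw : K → K → K → Prop) (r : K → K → Prop) (x y z : K) : Prop :=
  ∃ y₀ : K, r y y₀ ∧ ∀ x' z' : K, r x x' → r z z' → btw x' y₀ z'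

/-- The induced betweenness on the quotient `Quot r`. -/
def quotBtwQ (btw : K → K → K → Prop) (r : K → K → Prop) :
    Quot r → Quot r → Quot r → Prop := fun X Y Z =>
  ∃ x y z : K, Quot.mk r x = X ∧ Quot.mk r y = Y ∧ Quot.mk r z = Z ∧ qBtw btw r x y z

/-- The transfinite sequence of relations `∼_α` on a pretree `K`:
`∼₀` is equality; `∼_{α+1}` identifies `x, y` whenever the closed interval
between their classes in `K_α = K/∼_α` contains only finitely many classes;
at limits one takes the union. -/
noncomputable def relSeq (btw : K → K → K → Prop) (α : Ordinal.{v}) : K → K → Prop :=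
  Ordinal.limitRecOn α (· = ·)
    (fun _ r => fun x y => ∃ S : Set K, S.Finite ∧
      ∀ w : K, (qBtw btw r x w y ∨ r w x ∨ r w y) → ∃ s ∈ S, r w s)
    (fun α _ ih => fun x y => ∃ β : Ordinal, ∃ h : β < α, ih β h x y)

/-! ### Continua and cut points -/

variable {M : Type u} [TopologicalSpace M]

/-- A cut point of a connected space: a point whose complement is disconnected. -/
def IsCutPoint (M : Type u) [TopologicalSpace M] (c : M) : Prop :=
  ¬ IsPreconnected ({c}ᶜ : Set M)

/-- `c` is between `a` and `b` relative to the family `C` of cut points: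
`c ∈ C` and the complement of `c` is a disjoint union of open sets separating
`a` from `b`. -/
def mBtw (C : Set M) (a c b : M) : Prop :=
  c ∈ C ∧ ∃ U V : Set M, IsOpen U ∧ IsOpen V ∧ U ∩ V = ∅ ∧
    U ∪ V = ({c}ᶜ : Set M) ∧ a ∈ U ∧ b ∈ V

/-- The equivalence relation on `M` dual to `C`: each `c ∈ C` is equivalent only
to itself, and points of `M \ C` are equivalent iff no point separates them. -/
def cpRel (C : Set M) (a b : M) : Prop :=
  a = b ∨ (a ∉ C ∧ b ∉ C ∧ ¬ ∃ c : M, mBtw C a c b)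

/-- The equivalence class of a point. -/
def CPClass (C : Set M) (a : M) : Set M := {b | cpRel C a b}

/-- The underlying set of the cut point pretree of `M` dual to `C`:
the set of equivalence classes. -/
def CutPretree (M : Type u) [TopologicalSpace M] (C : Set M) : Type u :=
  {A : Set M // ∃ a : M, A = CPClass C a}

/-- Betweenness for (underlying sets of) classes: `z` is between `x` and `y`. -/
def kBtwSet (C : Set M) (x z y : Set M) : Prop :=
  (∃ c ∈ C, z = {c} ∧ ∀ a ∈ x, ∀ b ∈ y, mBtw C a c b) ∨
  ((∀ c ∈ z, c ∉ C) ∧ ∀ a ∈ x, ∀ b ∈ y, ∀ c ∈ z,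
      insert a {t : M | mBtw C a t c} ∩ insert b {t : M | mBtw C c t b} = (∅ : Set M))

/-- The betweenness relation of the cut point pretree of `M` dual to `C`. -/
def kBtw (M : Type u) [TopologicalSpace M] (C : Set M) :
    CutPretree M C → CutPretree M C → CutPretree M C → Prop :=
  fun x z y => kBtwSet C x.1 z.1 y.1

/-- The relation `≈` defining the dendrite quotient `D(M,C)`: `x ≈ y` iff the
set of points of `C` between `x` and `y` contains no subset order-isomorphic
to `ℚ`. -/
def dRel (C : Set M) (x y : M) : Prop :=
  ¬ ∃ f : ℚ → M, (∀ q : ℚ, f q ∈ C ∧ mBtw C x (f q) y) ∧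
    ∀ q q' : ℚ, q < q' → mBtw C x (f q) (f q')

/-! ### Dynamics -/

/-- The set of ordered distinct triples. -/
def DistinctTriples (M : Type u) : Set (M × M × M) :=
  {p | p.1 ≠ p.2.1 ∧ p.1 ≠ p.2.2 ∧ p.2.1 ≠ p.2.2}

/-- The diagonal action of a map on triples. -/
def tripleMap (f : M → M) : M × M × M → M × M × M :=
  fun p => (f p.1, f p.2.1, f p.2.2)

variable {Γ : Type w} [Group Γ]

/-- A convergence group action: `M` has at least three points, each element
acts as a homeomorphism (continuously), and the induced action on the space of
distinct triples is properly discontinuous. -/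
def IsConvergenceAction {M : Type u} [TopologicalSpace M] (act : Γ → M → M) : Prop :=
  (∃ a b c : M, a ≠ b ∧ a ≠ c ∧ b ≠ c) ∧
  (∀ g : Γ, Continuous (act g)) ∧
  (∀ L : Set (M × M × M), L ⊆ DistinctTriples M → IsCompact L →
    {g : Γ | (tripleMap (act g) '' L ∩ L).Nonempty}.Finite)

/-- A minimal action: no proper nonempty closed invariant subset. -/
def IsMinimalAction {M : Type u} [TopologicalSpace M] (act : Γ → M → M) : Prop :=
  ∀ A : Set M, IsClosed A → A.Nonempty → (∀ g : Γ, act g '' A ⊆ A) → A = Set.univ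

/-- A parabolic point: fixed by some infinite subgroup that fixes no other point. -/
def IsParabolicPoint {M : Type u} (act : Γ → M → M) (p : M) : Prop :=
  ∃ H : Subgroup Γ, (H : Set Γ).Infinite ∧ (∀ h ∈ H, act h p = p) ∧
    ∀ q : M, (∀ h ∈ H, act h q = q) → q = p

/-- An elementary subset of a convergence group: finite, or preserving setwise
a nonempty subset of `M` with at most two points. -/
def IsElementarySubset {M : Type u} (act : Γ → M → M) (S : Set Γ) : Prop :=
  S.Finite ∨ ∃ A : Set M, A.Nonempty ∧ (∃ a b : M, A ⊆ {a, b}) ∧ ∀ g ∈ S, act g '' A = A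

/-- `Γ` splits relative to `PP` over torsion subgroups: `Γ` acts by graph
automorphisms on a simplicial tree, without inversions, with no global fixed
vertex, with torsion edge stabilizers, and with each member of `PP` fixing a
vertex. -/
def SplitsOverTorsionRel (Γ : Type w) [Group Γ] (PP : Set (Subgroup Γ)) : Prop :=
  ∃ (V : Type w) (T : SimpleGraph V) (act : Γ →* Equiv.Perm V),
    T.IsTree ∧
    (∀ (g : Γ) (u v : V), T.Adj u v → T.Adj (act g u) (act g v)) ∧
    (∀ (g : Γ) (u v : V), T.Adj u v → ¬ (act g u = v ∧ act g v = u)) ∧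
    (¬ ∃ v : V, ∀ g : Γ, act g v = v) ∧
    (∀ u v : V, T.Adj u v → ∀ g : Γ, act g u = u → act g v = v → IsOfFinOrder g) ∧
    (∀ P ∈ PP, ∃ v : V, ∀ g ∈ P, act g v = v)

/-- A null family: for each open cover, all but finitely many members of the
family are contained in a single member of the cover. -/
def NullFamily (X : Type u) [TopologicalSpace X] (𝒞 : Set (Set X)) : Prop :=
  ∀ 𝒰 : Set (Set X), (∀ U ∈ 𝒰, IsOpen U) → ⋃₀ 𝒰 = Set.univ →
    {A ∈ 𝒞 | ¬ ∃ U ∈ 𝒰, A ⊆ U}.Finite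

end RelHypBoundary

namespace RelHypBoundary

section Pretree

variable {K : Type*} {B : K → K → K → Prop}

namespace IsPretree

theorem not_btw_left (hB : IsPretree B) {x y : K} : ¬ B x x y := fun h =>
  hB.asymm (hB.symm h) (hB.symm h)

theorem ne_left (hB : IsPretree B) {x y z : K} (h : B x y z) : y ≠ x := by
  rintro rfl
  exact hB.not_btw_left h

theorem ne_right (hB : IsPretree B) {x y z : K} (h : B x y z) : y ≠ z :=
  hB.ne_left (hB.symm h)

theorem right_of_btw (hB : IsPretree B) {x v w y : K} (hv : B x v w) (hw : B x w y) :
    B v w y :=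
  (hB.split v hw (hB.ne_right hv).symm).resolve_left (hB.asymm hv)

theorem trans (hB : IsPretree B) {x v w y : K} (hv : B x v w) (hw : B x w y) : B x v y := by
  by_cases h : v = y
  · subst h
    exact absurd hw (hB.asymm hv)
  · exact (hB.split y hv h).resolve_right fun h' =>
      hB.asymm (hB.symm (hB.right_of_btw hv hw)) h'

theorem total (hB : IsPretree B) {x y c d : K} (hc : B x c y) (hd : B x d y) (hne : c ≠ d) :
    B x c d ∨ B x d c := by
  by_contra! h
  exact hB.asymm (hB.symm ((hB.split d hc hne).resolve_left h.1))
    (hB.symm ((hB.split c hd hne.symm).resolve_left h.2))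

theorem btw_of_btw_of_btw (hB : IsPretree B) {x y v c w : K} (hw : B x w y) (hvw : B x v w)
    (hc : B v c w) : B x v c ∧ B c w y ∧ B x c y := by
  have hxc : B x v c :=
    (hB.split c hvw (hB.ne_left hc).symm).resolve_right fun h =>
      hB.asymm (hB.symm hc) (hB.symm h)
  have hxcw : B x c w := by
    by_cases hcx : c = x
    · subst hcx
      exact absurd rfl (hB.ne_of_btw hxc)
    · exact (hB.split x hc hcx).elim (fun h => absurd (hB.symm h) (hB.asymm hxc)) id
  exact ⟨hxc, hB.right_of_btw hxcw hw, hB.trans hxcw hw⟩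

end IsPretree

theorem mem_closedInt {x y z : K} : z ∈ closedInt B x y ↔ B x z y ∨ z = x ∨ z = y := by
  simp only [closedInt, openInt, mem_union, mem_ofPred_eq, mem_insert_iff, mem_singleton_iff]

theorem left_mem_closedInt (x y : K) : x ∈ closedInt B x y := by simp [mem_closedInt]

theorem right_mem_closedInt (x y : K) : y ∈ closedInt B x y := by simp [mem_closedInt]

theorem IsPretree.closedInt_comm (hB : IsPretree B) (x y : K) :
    closedInt B x y = closedInt B y x := by
  ext z
  have : B x z y ↔ B y z x := ⟨hB.symm, hB.symm⟩
  simp only [mem_closedInt, this]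
  tauto

theorem IsPretree.closedInt_self (hB : IsPretree B) (x : K) : closedInt B x x = {x} := by
  ext z
  have : ¬ B x z x := fun h => hB.ne_of_btw h rfl
  simp [mem_closedInt, this]

theorem IsPretree.closedInt_subset_union (hB : IsPretree B) (x y z : K) :
    closedInt B x z ⊆ closedInt B x y ∪ closedInt B y z := by
  intro w hw
  simp only [mem_union, mem_closedInt] at hw ⊢
  by_cases h : w = y
  · tauto
  · have := hB.split y (x := x) (y := w) (z := z)
    tauto

theorem IsPretree.closedInt_subset (hB : IsPretree B) {x y w : K} (hw : w ∈ closedInt B x y) :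
    closedInt B x w ⊆ closedInt B x y := by
  intro v hv
  rw [mem_closedInt] at hv
  rcases hv with hv | rfl | rfl
  · rw [mem_closedInt] at hw
    rcases hw with hw | rfl | rfl
    · exact mem_closedInt.2 (Or.inl (hB.trans hv hw))
    · exact absurd rfl (hB.ne_of_btw hv)
    · exact mem_closedInt.2 (Or.inl hv)
  · exact left_mem_closedInt _ _
  · exact hw

/-- An equivalence relation with full classes, for the betweenness `B`. -/
structure IsFullEquiv (B : K → K → K → Prop) (r : K → K → Prop) : Prop where
  equiv : Equivalence r
  full : ∀ {x y w : K}, r x y → w ∈ closedInt B x y → r x w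

/-- The relation identifying `x` and `y` when the interval `[x,y]` meets only finitely many
`r`-classes. -/
def finRel (B : K → K → K → Prop) (r : K → K → Prop) (x y : K) : Prop :=
  ∃ S : Set K, S.Finite ∧ ∀ w ∈ closedInt B x y, ∃ s ∈ S, r w s

theorem IsFullEquiv.eq (hB : IsPretree B) : IsFullEquiv B (· = ·) where
  equiv := eq_equivalence
  full := by
    rintro x _ w rfl hw
    rw [hB.closedInt_self] at hw
    exact hw.symm

theorem IsFullEquiv.le_finRel {r : K → K → Prop} (hr : IsFullEquiv B r) {x y : K}
    (h : r x y) : finRel B r x y :=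
  ⟨{x}, finite_singleton x, fun _ hw => ⟨x, rfl, hr.equiv.symm (hr.full h hw)⟩⟩

theorem IsFullEquiv.finRel (hB : IsPretree B) {r : K → K → Prop} (hr : IsFullEquiv B r) :
    IsFullEquiv B (finRel B r) where
  equiv :=
    { refl := fun x => hr.le_finRel (hr.equiv.refl x)
      symm := by
        rintro x y ⟨S, hS, h⟩
        exact ⟨S, hS, hB.closedInt_comm x y ▸ h⟩
      trans := by
        rintro x y z ⟨S, hS, h⟩ ⟨T, hT, h'⟩
        refine ⟨S ∪ T, hS.union hT, fun w hw => ?_⟩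
        rcases hB.closedInt_subset_union x y z hw with hw | hw
        · obtain ⟨s, hs, hws⟩ := h w hw
          exact ⟨s, Or.inl hs, hws⟩
        · obtain ⟨s, hs, hws⟩ := h' w hw
          exact ⟨s, Or.inr hs, hws⟩ }
  full := by
    rintro x y w ⟨S, hS, h⟩ hw
    exact ⟨S, hS, fun v hv => h v (hB.closedInt_subset hw hv)⟩

/-- A betweenness relation and its irreflexive part define the same closed intervals in the
quotient by a full equivalence relation. -/
theorem qBtw_or_iff {btw : K → K → K → Prop} (hB : IsPretree B)
    (hbtw : ∀ x z y, B x z y ↔ btw x z y ∧ z ≠ x ∧ z ≠ y) {r : K → K → Prop}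
    (hr : IsFullEquiv B r) (x w y : K) :
    (qBtw btw r x w y ∨ r w x ∨ r w y) ↔ ∃ v ∈ closedInt B x y, r w v := by
  have hr' := hr.equiv
  constructor
  · rintro (⟨v, hwv, h⟩ | h | h)
    · refine ⟨v, mem_closedInt.2 ?_, hwv⟩
      have := (hbtw x v y).2
      have := h x y (hr'.refl x) (hr'.refl y)
      tauto
    · exact ⟨x, left_mem_closedInt _ _, h⟩
    · exact ⟨y, right_mem_closedInt _ _, h⟩
  · rintro ⟨v, hv, hwv⟩
    rcases mem_closedInt.1 hv with hv | rfl | rfl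
    · by_cases hx : r w x
      · tauto
      by_cases hy : r w y
      · tauto
      have hvx : ¬ r x v := fun h => hx (hr'.trans hwv (hr'.symm h))
      have hvy : ¬ r y v := fun h => hy (hr'.trans hwv (hr'.symm h))
      refine Or.inl ⟨v, hwv, fun x' y' hx' hy' => ((hbtw _ _ _).1 ?_).1⟩
      have h1 : B x' v y := by
        refine (hB.split x' hv (by rintro rfl; exact hvx hx')).resolve_left fun h => ?_
        exact hvx (hr.full hx' (mem_closedInt.2 (Or.inl h)))
      refine (hB.split y' h1 (by rintro rfl; exact hvy hy')).resolve_right fun h => ?_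
      exact hvy (hr.full hy' (mem_closedInt.2 (Or.inl (hB.symm h))))
    · tauto
    · tauto

end Pretree

section RelSeq

variable {K : Type*} {B btw : K → K → K → Prop}

theorem relSeq_zero : relSeq btw (0 : Ordinal.{v}) = (· = ·) := by
  simp [relSeq]

theorem relSeq_limit {α : Ordinal.{v}} (hα : Order.IsSuccLimit α) (x y : K) :
    relSeq btw α x y ↔ ∃ β < α, relSeq btw β x y := by
  simp [relSeq, Ordinal.limitRecOn_limit _ _ _ _ hα]

theorem relSeq_add_one (hB : IsPretree B)
    (hbtw : ∀ x z y, B x z y ↔ btw x z y ∧ z ≠ x ∧ z ≠ y) {α : Ordinal.{v}}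
    (h : IsFullEquiv B (relSeq btw α)) :
    relSeq btw (α + 1) = finRel B (relSeq btw α) := by
  funext x y
  have : relSeq btw (α + 1) x y ↔ ∃ S : Set K, S.Finite ∧
      ∀ w : K, (qBtw btw (relSeq btw α) x w y ∨ relSeq btw α w x ∨ relSeq btw α w y) →
        ∃ s ∈ S, relSeq btw α w s := by
    simp [relSeq]
  simp only [eq_iff_iff, this, qBtw_or_iff hB hbtw h, finRel]
  refine exists_congr fun S => and_congr_right fun _ => ⟨fun H w hw => ?_, ?_⟩
  · exact H w ⟨w, hw, h.equiv.refl w⟩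
  · rintro H w ⟨v, hv, hwv⟩
    obtain ⟨s, hs, hvs⟩ := H v hv
    exact ⟨s, hs, h.equiv.trans hwv hvs⟩

theorem relSeq_isFullEquiv_and_mono (hB : IsPretree B)
    (hbtw : ∀ x z y, B x z y ↔ btw x z y ∧ z ≠ x ∧ z ≠ y) (β : Ordinal.{v}) :
    IsFullEquiv B (relSeq btw β) ∧
      ∀ α ≤ β, ∀ x y, relSeq btw α x y → relSeq btw β x y := by
  induction β using Ordinal.limitRecOn with
  | zero =>
    refine ⟨relSeq_zero (btw := btw) ▸ IsFullEquiv.eq hB, fun α hα x y h => ?_⟩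
    rwa [nonpos_iff_eq_zero.1 hα] at h
  | add_one β ih =>
    obtain ⟨hf, hm⟩ := ih
    rw [relSeq_add_one hB hbtw hf]
    refine ⟨hf.finRel hB, fun α hα x y h => ?_⟩
    rcases hα.eq_or_lt with rfl | hα
    · rwa [relSeq_add_one hB hbtw hf] at h
    · exact hf.le_finRel (hm α (Order.lt_add_one_iff.1 hα) x y h)
  | limit β hβ ih =>
    refine ⟨⟨⟨fun x => ?_, fun {x y} h => ?_, fun {x y z} h h' => ?_⟩, fun {x y w} h hw => ?_⟩,
      fun α hα x y h => ?_⟩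
    · rw [relSeq_limit hβ]
      exact ⟨0, hβ.bot_lt, relSeq_zero (btw := btw) ▸ rfl⟩
    · rw [relSeq_limit hβ] at h ⊢
      obtain ⟨α, hα, h⟩ := h
      exact ⟨α, hα, (ih α hα).1.equiv.symm h⟩
    · rw [relSeq_limit hβ] at h h' ⊢
      obtain ⟨α, hα, h⟩ := h
      obtain ⟨γ, hγ, h'⟩ := h'
      have hm := max_lt hα hγ
      exact ⟨max α γ, hm, (ih _ hm).1.equiv.trans ((ih _ hm).2 α (le_max_left _ _) _ _ h)
        ((ih _ hm).2 γ (le_max_right _ _) _ _ h')⟩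
    · rw [relSeq_limit hβ] at h ⊢
      obtain ⟨α, hα, h⟩ := h
      exact ⟨α, hα, (ih α hα).1.full h hw⟩
    · rcases hα.eq_or_lt with rfl | hα
      · exact h
      · exact (relSeq_limit hβ x y).2 ⟨α, hα, h⟩

theorem exists_relSeq_add_one_eq {K : Type u} {B btw : K → K → K → Prop} (hB : IsPretree B)
    (hbtw : ∀ x z y, B x z y ↔ btw x z y ∧ z ≠ x ∧ z ≠ y) :
    ∃ α : Ordinal.{u}, relSeq btw (α + 1) = relSeq btw α := by
  by_contra! h
  refine not_injective_of_ordinal (fun α : Ordinal.{u} => relSeq btw α)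
    (.of_lt_imp_ne fun α β hαβ hE => h α ?_)
  funext x y
  refine propext ⟨fun H => ?_, (relSeq_isFullEquiv_and_mono hB hbtw _).2 _ le_self_add x y⟩
  have := (relSeq_isFullEquiv_and_mono hB hbtw β).2 _ (Order.add_one_le_of_lt hαβ) x y H
  exact (congrFun (congrFun hE x) y).mpr this

theorem not_relSeq_of_rat (hB : IsPretree B)
    (hbtw : ∀ x z y, B x z y ↔ btw x z y ∧ z ≠ x ∧ z ≠ y) (α : Ordinal.{v}) :
    ∀ (x y : K) (f : ℚ → K), (∀ q, B x (f q) y) → (∀ q q', q < q' → B x (f q) (f q')) →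
      ¬ relSeq btw α x y := by
  induction α using Ordinal.limitRecOn with
  | zero =>
    intro x y f hf _ h
    rw [relSeq_zero] at h
    exact hB.ne_of_btw (hf 0) h
  | add_one α ih =>
    intro x y f hf hlt h
    have hα := (relSeq_isFullEquiv_and_mono hB hbtw α).1
    rw [relSeq_add_one hB hbtw hα] at h
    obtain ⟨S, hS, h⟩ := h
    choose g hgS hg using fun q => h (f q) (mem_closedInt.2 (Or.inl (hf q)))
    have key : ∀ q q', q < q' → g q ≠ g q' := by
      intro q q' hq hE
      obtain ⟨p, hp⟩ := exists_between hq
      obtain ⟨p', hp'⟩ := exists_between hp.2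
      have : Nontrivial (Ioo q q') :=
        ⟨⟨p, hp⟩, ⟨p', hp.1.trans hp'.1, hp'.2⟩, fun h => hp'.1.ne (congrArg Subtype.val h)⟩
      obtain ⟨e⟩ := Order.embedding_from_countable_to_dense ℚ (Ioo q q')
      refine ih (f q) (f q') (fun p => f (e p)) (fun p => ?_) (fun p p' hp => ?_)
        (hα.equiv.trans (hg q) (hE ▸ hα.equiv.symm (hg q')))
      · exact hB.right_of_btw (hlt _ _ (e p).2.1) (hlt _ _ (e p).2.2)
      · exact hB.right_of_btw (hlt _ _ (e p).2.1) (hlt _ _ (e.lt_iff_lt.2 hp))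
    have hinj : Function.Injective g := .of_lt_imp_ne key
    exact (infinite_range_of_injective hinj) (hS.subset (range_subset_iff.2 hgS))
  | limit α hα ih =>
    intro x y f hf hlt h
    obtain ⟨β, hβ, h⟩ := (relSeq_limit hα x y).1 h
    exact ih β hβ x y f hf hlt h

end RelSeq

section RatEmbedding

variable {K : Type*} {B : K → K → K → Prop} {P : Set K} {r : K → K → Prop}

theorem exists_btw_of_not_rel (hB : IsPretree B)
    (hP : ∀ x y, x ≠ y → x ∉ P → y ∉ P → ∃ c ∈ P, B x c y) (hr : IsFullEquiv B r)
    (hfin : ∀ x y, finRel B r x y → r x y) {x y : K} (hxy : ¬ r x y) :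
    ∃ c ∈ P, B x c y ∧ ¬ r x c ∧ ¬ r y c := by
  have hsymm : ∀ {a b}, r a b → r b a := hr.equiv.symm
  have hS : ∀ S : Set K, S.Finite → x ∈ S → y ∈ S →
      ∃ w, B x w y ∧ ∀ s ∈ S, ¬ r w s := by
    intro S hS hx hy
    by_contra! h
    refine hxy (hfin x y ⟨S, hS, fun w hw => ?_⟩)
    rcases mem_closedInt.1 hw with hw | rfl | rfl
    · exact h w hw
    · exact ⟨_, hx, hr.equiv.refl _⟩
    · exact ⟨_, hy, hr.equiv.refl _⟩
  obtain ⟨v, hv, hvS⟩ := hS {x, y} (by simp) (by simp) (by simp)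
  obtain ⟨w, hw, hwS⟩ := hS {x, y, v} (by simp) (by simp) (by simp)
  simp only [mem_insert_iff, mem_singleton_iff, forall_eq_or_imp, forall_eq] at hvS hwS
  by_cases hvP : v ∈ P
  · exact ⟨v, hvP, hv, fun h => hvS.1 (hsymm h), fun h => hvS.2 (hsymm h)⟩
  by_cases hwP : w ∈ P
  · exact ⟨w, hwP, hw, fun h => hwS.1 (hsymm h), fun h => hwS.2.1 (hsymm h)⟩
  have hne : v ≠ w := by
    rintro rfl
    exact hwS.2.2 (hr.equiv.refl _)
  obtain ⟨c, hcP, hc⟩ := hP v w hne hvP hwP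
  rcases hB.total hv hw hne with h | h
  · obtain ⟨h1, h2, h3⟩ := hB.btw_of_btw_of_btw hw h hc
    exact ⟨c, hcP, h3, fun H => hvS.1 (hsymm (hr.full H (mem_closedInt.2 (Or.inl h1)))),
      fun H => hwS.2.1 (hsymm (hr.full H (mem_closedInt.2 (Or.inl (hB.symm h2)))))⟩
  · obtain ⟨h1, h2, h3⟩ := hB.btw_of_btw_of_btw hv h (hB.symm hc)
    exact ⟨c, hcP, h3, fun H => hwS.1 (hsymm (hr.full H (mem_closedInt.2 (Or.inl h1)))),
      fun H => hvS.2 (hsymm (hr.full H (mem_closedInt.2 (Or.inl (hB.symm h2)))))⟩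

open Classical in
/-- The order, with least endpoint `x`, on a set of points of the interval `(x,y)`. -/
noncomputable abbrev intervalOrder (hB : IsPretree B) (x y : K) (T : Set K)
    (hT : ∀ c ∈ T, B x c y) : LinearOrder T where
  le c d := c = d ∨ B x c d
  le_refl c := Or.inl rfl
  le_trans := by
    rintro a b c (rfl | h) (rfl | h')
    · exact Or.inl rfl
    · exact Or.inr h'
    · exact Or.inr h
    · exact Or.inr (hB.trans h h')
  le_antisymm := by
    rintro a b (rfl | h) (h' | h')
    · rfl
    · rfl
    · exact h'.symm
    · exact absurd h' (hB.asymm h)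
  le_total a b := by
    by_cases h : a = b
    · exact Or.inl (Or.inl h)
    · exact (hB.total (hT a a.2) (hT b b.2) fun H => h (Subtype.ext H)).imp Or.inr Or.inr
  toDecidableLE := Classical.decRel _

theorem exists_rat_of_not_rel (hB : IsPretree B)
    (hP : ∀ x y, x ≠ y → x ∉ P → y ∉ P → ∃ c ∈ P, B x c y) (hr : IsFullEquiv B r)
    (hfin : ∀ x y, finRel B r x y → r x y) {x y : K} (hxy : ¬ r x y) :
    ∃ f : ℚ → K, (∀ q, f q ∈ P ∧ B x (f q) y) ∧ ∀ q q', q < q' → B x (f q) (f q') := by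
  have hsymm : ∀ {a b}, r a b → r b a := hr.equiv.symm
  have dense := fun a b (h : ¬ r a b) => exists_btw_of_not_rel hB hP hr hfin h
  let L := {c : K // c ∈ P ∧ B x c y}
  let s : Setoid L := ⟨fun a b => r a b, fun a => hr.equiv.refl _, fun h => hr.equiv.symm h,
    fun h h' => hr.equiv.trans h h'⟩
  let rep : L → K := fun c => (Quotient.out (Quotient.mk s c)).1
  have hrep : ∀ c : L, r (rep c) c := fun c => Quotient.mk_out (s := s) c
  have hrep_eq : ∀ c d : L, r c d → rep c = rep d := fun c d h => by
    simp only [rep]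
    rw [Quotient.sound (s := s) h]
  let T : Set K := range rep
  have hT : ∀ c ∈ T, c ∈ P ∧ B x c y := by
    rintro _ ⟨c, rfl⟩
    exact (Quotient.out (Quotient.mk s c)).2
  have hTr : ∀ c ∈ T, ∀ d ∈ T, r c d → c = d := by
    rintro _ ⟨c, rfl⟩ _ ⟨d, rfl⟩ h
    exact hrep_eq c d (hr.equiv.trans (hsymm (hrep c)) (hr.equiv.trans h (hrep d)))
  let _ : LinearOrder T := intervalOrder hB x y T fun c hc => (hT c hc).2
  have hlt : ∀ a b : T, a < b ↔ B x a b := fun a b => by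
    rw [lt_iff_le_and_ne]
    constructor
    · rintro ⟨h | h, hne⟩
      · exact absurd h hne
      · exact h
    · exact fun h => ⟨Or.inr h, fun hE => hB.ne_right h (congrArg _ hE)⟩
  have : DenselyOrdered T := by
    refine ⟨fun a b hab => ?_⟩
    have hab' := (hlt a b).1 hab
    obtain ⟨c, hcP, hc, hac, hbc⟩ := dense a b fun h => hab.ne (Subtype.ext (hTr a a.2 b b.2 h))
    have hb := (hT b b.2).2
    obtain ⟨h1, h2, h3⟩ := hB.btw_of_btw_of_btw hb hab' hc
    let c' : L := ⟨c, hcP, h3⟩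
    have hcr := hrep c'
    refine ⟨⟨rep c', mem_range_self _⟩, not_le.1 ?_, not_le.1 ?_⟩
    · rintro (h | h)
      · exact hac (congrArg Subtype.val h ▸ hcr)
      · exact hac (hr.equiv.trans (hsymm (hr.full hcr (mem_closedInt.2 (Or.inl
          (hB.right_of_btw h h1))))) hcr)
    · rintro (h | h)
      · exact hbc (congrArg Subtype.val h ▸ hcr)
      · have hcb : B x c b := hB.symm (hB.right_of_btw (hB.symm h2) (hB.symm h3))
        exact hbc (hsymm (hr.full (hsymm hcr) (mem_closedInt.2 (Or.inl
          (hB.right_of_btw hcb h)))))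
  have : Nontrivial T := by
    obtain ⟨c, hcP, hc, hxc, hyc⟩ := dense x y hxy
    obtain ⟨d, hdP, hd, hcd, hyd⟩ := dense c y fun h => hyc (hsymm h)
    have hd' : B x d y := hB.symm (hB.trans (hB.symm hd) (hB.symm hc))
    refine ⟨⟨rep ⟨c, hcP, hc⟩, mem_range_self _⟩, ⟨rep ⟨d, hdP, hd'⟩, mem_range_self _⟩, ?_⟩
    intro h
    have h : rep ⟨c, hcP, hc⟩ = rep ⟨d, hdP, hd'⟩ := congrArg (fun t : T => (t : K)) h
    exact hcd (hr.equiv.trans (hsymm (hrep ⟨c, hcP, hc⟩)) (h ▸ hrep ⟨d, hdP, hd'⟩))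
  obtain ⟨e⟩ := Order.embedding_from_countable_to_dense ℚ T
  exact ⟨fun q => e q, fun q => hT _ (e q).2, fun q q' h => (hlt _ _).1 (e.lt_iff_lt.2 h)⟩

end RatEmbedding

section CutPoints

variable {M : Type u} [TopologicalSpace M] {C : Set M}

theorem mBtw.ne {a c b : M} (h : mBtw C a c b) : a ≠ b := by
  rintro rfl
  obtain ⟨-, U, V, -, -, hUV, -, ha, hb⟩ := h
  exact (hUV ▸ (⟨ha, hb⟩ : a ∈ U ∩ V) : a ∈ (∅ : Set M))

theorem mBtw.symm {a c b : M} (h : mBtw C a c b) : mBtw C b c a := by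
  obtain ⟨hc, U, V, hU, hV, hUV, hc', ha, hb⟩ := h
  exact ⟨hc, V, U, hV, hU, inter_comm U V ▸ hUV, union_comm U V ▸ hc', hb, ha⟩

theorem mBtw.ne_left {a c b : M} (h : mBtw C a c b) : c ≠ a := by
  rintro rfl
  obtain ⟨-, U, V, -, -, -, hc', ha, -⟩ := h
  exact (hc' ▸ Or.inl ha : c ∈ ({c}ᶜ : Set M)) rfl

theorem mBtw.ne_right {a c b : M} (h : mBtw C a c b) : c ≠ b := h.symm.ne_left

theorem mBtw.split {a c b : M} (h : mBtw C a c b) (w : M) (hw : c ≠ w) :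
    mBtw C a c w ∨ mBtw C w c b := by
  obtain ⟨hc, U, V, hU, hV, hUV, hc', ha, hb⟩ := h
  have : w ∈ U ∪ V := hc' ▸ hw.symm
  rcases this with h | h
  · exact Or.inr ⟨hc, U, V, hU, hV, hUV, hc', h, hb⟩
  · exact Or.inl ⟨hc, U, V, hU, hV, hUV, hc', ha, h⟩

theorem mBtw.asymm [PreconnectedSpace M] {x y z : M} (h : mBtw C x y z) : ¬ mBtw C x z y := by
  rintro ⟨-, U', V', hU', hV', hUV', hz, hx', hy'⟩
  obtain ⟨-, U, V, hU, hV, hUV, hy, hx, hz'⟩ := h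
  have hcover : univ ⊆ (U ∩ U') ∪ (V ∪ V') := fun m _ => by
    by_cases hmy : m = y
    · exact Or.inr (Or.inr (hmy ▸ hy'))
    by_cases hmz : m = z
    · exact Or.inr (Or.inl (hmz ▸ hz'))
    have h1 : m ∈ U ∪ V := hy ▸ hmy
    have h2 : m ∈ U' ∪ V' := hz ▸ hmz
    simp only [mem_union, mem_inter_iff] at h1 h2 ⊢
    tauto
  obtain ⟨m, -, hm, hm'⟩ := isPreconnected_univ (α := M) (U ∩ U') (V ∪ V') (hU.inter hU')
    (hV.union hV') hcover ⟨x, trivial, hx, hx'⟩ ⟨z, trivial, Or.inl hz'⟩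
  rcases hm' with h | h
  · exact (hUV ▸ (⟨hm.1, h⟩ : m ∈ U ∩ V) : m ∈ (∅ : Set M))
  · exact (hUV' ▸ (⟨hm.2, h⟩ : m ∈ U' ∩ V') : m ∈ (∅ : Set M))

theorem cpRel_equivalence (C : Set M) : Equivalence (cpRel C) where
  refl _ := Or.inl rfl
  symm := by
    rintro a b (rfl | ⟨ha, hb, h⟩)
    · exact Or.inl rfl
    · exact Or.inr ⟨hb, ha, fun ⟨c, hc⟩ => h ⟨c, hc.symm⟩⟩
  trans := by
    rintro a b c (rfl | ⟨ha, hb, h⟩) (rfl | ⟨hb', hc, h'⟩)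
    · exact Or.inl rfl
    · exact Or.inr ⟨hb', hc, h'⟩
    · exact Or.inr ⟨ha, hb, h⟩
    · refine Or.inr ⟨ha, hc, fun ⟨d, hd⟩ => ?_⟩
      rcases hd.split b (fun hE => hb (hE ▸ hd.1)) with H | H
      · exact h ⟨d, H⟩
      · exact h' ⟨d, H⟩

theorem cpRel.mem_iff {a b : M} (h : cpRel C a b) : a ∈ C ↔ b ∈ C := by
  rcases h with rfl | ⟨ha, hb, -⟩
  · rfl
  · exact iff_of_false ha hb

theorem cpRel.eq_of_mem {a b : M} (h : cpRel C a b) (ha : a ∈ C) : a = b :=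
  h.resolve_right fun h => h.1 ha

theorem mBtw.congr_left {a a' c b : M} (h : mBtw C a c b) (ha : cpRel C a a') :
    mBtw C a' c b := by
  rcases ha with rfl | ⟨-, ha', hn⟩
  · exact h
  · exact (h.split a' fun hE => ha' (hE ▸ h.1)).resolve_left fun H => hn ⟨c, H⟩

theorem mBtw.congr_right {a c b b' : M} (h : mBtw C a c b) (hb : cpRel C b b') :
    mBtw C a c b' :=
  (h.symm.congr_left hb).symm

/-- The point `t` of `C` lies in the half-open interval `[a,z)`. -/
def CutsOff (C : Set M) (a t z : M) : Prop := t ∈ C ∧ (t = a ∨ mBtw C a t z)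

theorem CutsOff.congr {a a' t z z' : M} (h : CutsOff C a t z) (ha : cpRel C a a')
    (hz : cpRel C z z') : CutsOff C a' t z' := by
  obtain ⟨ht, rfl | h⟩ := h
  · exact ⟨ht, Or.inl (ha.eq_of_mem ht)⟩
  · exact ⟨ht, Or.inr ((h.congr_left ha).congr_right hz)⟩

/-- The class of a point in the cut point pretree. -/
def cutClass (C : Set M) (a : M) : CutPretree M C := ⟨CPClass C a, a, rfl⟩

theorem cutClass_eq_iff {a b : M} : cutClass C a = cutClass C b ↔ cpRel C a b := by
  have he := cpRel_equivalence C
  refine ⟨fun h => ?_, fun h => Subtype.ext (Set.ext fun x => ?_)⟩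
  · have h : CPClass C a = CPClass C b := congrArg Subtype.val h
    have : b ∈ CPClass C a := h ▸ he.refl b
    exact this
  · exact ⟨fun hx => he.trans (he.symm h) hx, fun hx => he.trans h hx⟩

theorem cutClass_surjective (x : CutPretree M C) : ∃ a, cutClass C a = x := by
  obtain ⟨_, a, rfl⟩ := x
  exact ⟨a, rfl⟩

/-- The betweenness of the cut point pretree with the endpoints removed. -/
def strictBtw (M : Type u) [TopologicalSpace M] (C : Set M) (x z y : CutPretree M C) : Prop :=
  kBtw M C x z y ∧ z ≠ x ∧ z ≠ y

theorem kBtw_cutClass_of_mem {a z b : M} (hz : z ∈ C) :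
    kBtw M C (cutClass C a) (cutClass C z) (cutClass C b) ↔ mBtw C a z b := by
  have he := cpRel_equivalence C
  constructor
  · rintro (⟨c, hc, hzc, h⟩ | ⟨h, -⟩)
    · have : z ∈ ({c} : Set M) := hzc ▸ he.refl z
      rw [mem_singleton_iff.1 this]
      exact h a (he.refl a) b (he.refl b)
    · exact absurd hz (h z (he.refl z))
  · intro h
    refine Or.inl ⟨z, hz, Set.ext fun t => ⟨fun ht => (cpRel.eq_of_mem ht hz).symm, ?_⟩, ?_⟩
    · rintro rfl
      exact he.refl _
    · exact fun a' ha' b' hb' => (h.congr_left ha').congr_right hb'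

theorem strictBtw_cutClass_of_mem {a z b : M} (hz : z ∈ C) :
    strictBtw M C (cutClass C a) (cutClass C z) (cutClass C b) ↔ mBtw C a z b := by
  rw [strictBtw, kBtw_cutClass_of_mem hz]
  refine and_iff_left_of_imp fun h => ⟨fun hE => ?_, fun hE => ?_⟩
  · exact h.ne_left (cpRel.eq_of_mem (cutClass_eq_iff.1 hE) hz)
  · exact h.ne_right (cpRel.eq_of_mem (cutClass_eq_iff.1 hE) hz)

theorem strictBtw_cutClass_of_notMem {a z b : M} (hz : z ∉ C) :
    strictBtw M C (cutClass C a) (cutClass C z) (cutClass C b) ↔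
      ¬ cpRel C a b ∧ ¬ cpRel C z a ∧ ¬ cpRel C z b ∧
        ∀ t, CutsOff C a t z → ¬ CutsOff C b t z := by
  have he := cpRel_equivalence C
  simp only [strictBtw, ne_eq, cutClass_eq_iff]
  constructor
  · rintro ⟨⟨c, hc, hzc, -⟩ | ⟨-, h⟩, hza, hzb⟩
    · have : z ∈ ({c} : Set M) := hzc ▸ he.refl z
      exact absurd (mem_singleton_iff.1 this ▸ hc) hz
    · refine ⟨fun hab => ?_, hza, hzb, fun t ht ht' => ?_⟩
      · have : b ∈ (∅ : Set M) := h b hab b (he.refl b) z (he.refl z) ▸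
          ⟨mem_insert b _, mem_insert b _⟩
        exact this
      · have : t ∈ (∅ : Set M) := h a (he.refl a) b (he.refl b) z (he.refl z) ▸
          ⟨ht.2, ht'.2.imp_right mBtw.symm⟩
        exact this
  · rintro ⟨hab, hza, hzb, h⟩
    refine ⟨Or.inr ⟨fun c hc => fun hc' => hz ((cpRel.mem_iff hc).2 hc'), ?_⟩, hza, hzb⟩
    intro a' ha b' hb c hc
    refine eq_empty_of_forall_notMem fun t => ?_
    have key : t ∈ C → CutsOff C a' t c → ¬ CutsOff C b' t c := fun ht h1 h2 =>
      h t (h1.congr (he.symm ha) (he.symm hc)) (h2.congr (he.symm hb) (he.symm hc))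
    rintro ⟨h1 | h1, h2 | h2⟩
    · subst h1 h2
      exact hab (he.trans ha (he.symm hb))
    · exact key h2.1 ⟨h2.1, Or.inl h1⟩ ⟨h2.1, Or.inr h2.symm⟩
    · exact key h1.1 ⟨h1.1, Or.inr h1⟩ ⟨h1.1, Or.inl h2⟩
    · exact key h1.1 ⟨h1.1, Or.inr h1⟩ ⟨h1.1, Or.inr h2.symm⟩

theorem cutsOff_of_not_strictBtw {a z b : M} (hz : z ∉ C) (hab : ¬ cpRel C a b)
    (hza : ¬ cpRel C z a) (hzb : ¬ cpRel C z b)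
    (h : ¬ strictBtw M C (cutClass C a) (cutClass C z) (cutClass C b)) :
    ∃ t, CutsOff C a t z ∧ CutsOff C b t z := by
  rw [strictBtw_cutClass_of_notMem hz] at h
  push Not at h
  exact h hab hza hzb

theorem CutsOff.trans [PreconnectedSpace M] {a t s z : M} (ht : CutsOff C a t z)
    (hs : CutsOff C t s z) : CutsOff C a s z := by
  obtain ⟨htC, rfl | ht⟩ := ht
  · exact hs
  obtain ⟨hsC, rfl | hs⟩ := hs
  · exact ⟨hsC, Or.inr ht⟩
  refine ⟨hsC, ?_⟩
  by_cases hsa : s = a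
  · exact Or.inl hsa
  refine Or.inr ((hs.split a hsa).elim (fun h => ?_) id)
  rcases ht.symm.split s hs.ne_left.symm with H | H
  · exact absurd hs.symm H.asymm
  · exact absurd h.symm H.symm.asymm

theorem CutsOff.total [PreconnectedSpace M] {w t s z : M} (ht : CutsOff C w t z)
    (hs : CutsOff C w s z) : CutsOff C t s z ∨ CutsOff C s t z := by
  obtain ⟨htC, rfl | ht⟩ := ht
  · exact Or.inl hs
  obtain ⟨hsC, rfl | hs⟩ := hs
  · exact Or.inr ⟨htC, Or.inr ht⟩
  by_cases hst : s = t
  · exact Or.inl ⟨hsC, Or.inl hst⟩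
  rcases hs.split t hst with h | h
  · rcases ht.split s (Ne.symm hst) with h' | h'
    · exact absurd h' h.asymm
    · exact Or.inr ⟨htC, Or.inr h'⟩
  · exact Or.inl ⟨hsC, Or.inr h⟩

theorem strictBtw_isPretree [PreconnectedSpace M] : IsPretree (strictBtw M C) where
  ne_of_btw := by
    intro x z y h
    obtain ⟨a, rfl⟩ := cutClass_surjective x
    obtain ⟨b, rfl⟩ := cutClass_surjective y
    obtain ⟨z, rfl⟩ := cutClass_surjective z
    by_cases hz : z ∈ C
    · rw [strictBtw_cutClass_of_mem hz] at h
      rw [Ne, cutClass_eq_iff]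
      exact fun hab => (h.congr_left hab).ne rfl
    · rw [strictBtw_cutClass_of_notMem hz] at h
      rw [Ne, cutClass_eq_iff]
      exact h.1
  symm := by
    intro x z y h
    obtain ⟨a, rfl⟩ := cutClass_surjective x
    obtain ⟨b, rfl⟩ := cutClass_surjective y
    obtain ⟨z, rfl⟩ := cutClass_surjective z
    by_cases hz : z ∈ C
    · rw [strictBtw_cutClass_of_mem hz] at h ⊢
      exact h.symm
    · rw [strictBtw_cutClass_of_notMem hz] at h ⊢
      exact ⟨fun H => h.1 ((cpRel_equivalence C).symm H), h.2.2.1, h.2.1,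
        fun t ht ht' => h.2.2.2 t ht' ht⟩
  asymm := by
    intro x y z h h'
    obtain ⟨x, rfl⟩ := cutClass_surjective x
    obtain ⟨y, rfl⟩ := cutClass_surjective y
    obtain ⟨z, rfl⟩ := cutClass_surjective z
    by_cases hy : y ∈ C <;> by_cases hz : z ∈ C
    · rw [strictBtw_cutClass_of_mem hy] at h
      rw [strictBtw_cutClass_of_mem hz] at h'
      exact h.asymm h'
    · rw [strictBtw_cutClass_of_mem hy] at h
      rw [strictBtw_cutClass_of_notMem hz] at h'
      exact h'.2.2.2 y ⟨hy, Or.inr h⟩ ⟨hy, Or.inl rfl⟩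
    · rw [strictBtw_cutClass_of_notMem hy] at h
      rw [strictBtw_cutClass_of_mem hz] at h'
      exact h.2.2.2 z ⟨hz, Or.inr h'⟩ ⟨hz, Or.inl rfl⟩
    · rw [strictBtw_cutClass_of_notMem hy] at h
      rw [strictBtw_cutClass_of_notMem hz] at h'
      obtain ⟨t, ht⟩ : ∃ t, mBtw C y t z := by
        by_contra hn
        exact h.2.2.1 (Or.inr ⟨hy, hz, hn⟩)
      have h1 := h.2.2.2 t
      have h2 := h'.2.2.2 t
      by_cases htx : t = x
      · exact h1 ⟨ht.1, Or.inl htx⟩ ⟨ht.1, Or.inr ht.symm⟩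
      rcases ht.split x htx with H | H
      · exact h1 ⟨ht.1, Or.inr H.symm⟩ ⟨ht.1, Or.inr ht.symm⟩
      · exact h2 ⟨ht.1, Or.inr H⟩ ⟨ht.1, Or.inr ht⟩
  split := by
    intro x z y w h hzw
    obtain ⟨a, rfl⟩ := cutClass_surjective x
    obtain ⟨b, rfl⟩ := cutClass_surjective y
    obtain ⟨z, rfl⟩ := cutClass_surjective z
    obtain ⟨w, rfl⟩ := cutClass_surjective w
    by_cases hz : z ∈ C
    · simp only [strictBtw_cutClass_of_mem hz] at h ⊢
      exact h.split w fun hE => hzw (hE ▸ rfl)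
    · by_cases haw : cpRel C a w
      · rw [← cutClass_eq_iff.2 haw]
        exact Or.inr h
      by_cases hwb : cpRel C w b
      · rw [cutClass_eq_iff.2 hwb]
        exact Or.inl h
      by_contra! hn
      rw [Ne, cutClass_eq_iff] at hzw
      rw [strictBtw_cutClass_of_notMem hz] at h
      obtain ⟨-, hza, hzb, h⟩ := h
      obtain ⟨t, hat, hwt⟩ := cutsOff_of_not_strictBtw hz haw hza hzw hn.1
      obtain ⟨s, hws, hbs⟩ := cutsOff_of_not_strictBtw hz hwb hzw hzb hn.2
      rcases hwt.total hws with H | H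
      · exact h s (hat.trans H) hbs
      · exact h t hat (hbs.trans H)

end CutPoints

end RelHypBoundary

open RelHypBoundary Set

/-- The transfinite sequence `(K_α)` of quotients of the cut
point pretree stabilizes at some ordinal `α₀`, and the composite quotient map
`M → K → K_{α₀}` induces a well-defined bijection from the dendrite quotient
`D(M,C) = M/≈` onto `K_{α₀}`. -/
theorem dendrite_eq_stable_pretree {M : Type u} [TopologicalSpace M]
    [CompactSpace M] [ConnectedSpace M] [TopologicalSpace.MetrizableSpace M]
    (C : Set M) (hCne : C.Nonempty) (hC : ∀ c ∈ C, IsCutPoint M c) :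
    ∃ α₀ : Ordinal.{u},
      (∀ x y : CutPretree M C,
        relSeq (kBtw M C) (α₀ + 1) x y ↔ relSeq (kBtw M C) α₀ x y) ∧
      ∃ F : Quot (dRel C) → Quot (relSeq (kBtw M C) α₀),
        (∀ m : M, F (Quot.mk (dRel C) m) =
          Quot.mk (relSeq (kBtw M C) α₀) (⟨CPClass C m, ⟨m, rfl⟩⟩ : CutPretree M C)) ∧
        Function.Bijective F := by
  have hB : IsPretree (strictBtw M C) := strictBtw_isPretree
  have hbtw : ∀ x z y, strictBtw M C x z y ↔ kBtw M C x z y ∧ z ≠ x ∧ z ≠ y :=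
    fun _ _ _ => Iff.rfl
  obtain ⟨α, hα⟩ := exists_relSeq_add_one_eq hB hbtw
  have hr := (relSeq_isFullEquiv_and_mono hB hbtw α).1
  have hP : ∀ x y, x ≠ y → x ∉ cutClass C '' C → y ∉ cutClass C '' C →
      ∃ c ∈ cutClass C '' C, strictBtw M C x c y := by
    intro x y hxy hx hy
    obtain ⟨x, rfl⟩ := cutClass_surjective x
    obtain ⟨y, rfl⟩ := cutClass_surjective y
    by_contra hn
    refine hxy (cutClass_eq_iff.2 (Or.inr ⟨fun h => hx ⟨x, h, rfl⟩, fun h => hy ⟨y, h, rfl⟩,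
      fun ⟨c, hc⟩ => hn ⟨_, ⟨c, hc.1, rfl⟩, (strictBtw_cutClass_of_mem hc.1).2 hc⟩⟩))
  have key : ∀ a b, dRel C a b ↔ relSeq (kBtw M C) α (cutClass C a) (cutClass C b) := by
    intro a b
    constructor
    · refine fun h => by_contra fun hn => h ?_
      obtain ⟨f, hf, hlt⟩ := exists_rat_of_not_rel hB hP hr
        (fun x y h => hα ▸ relSeq_add_one hB hbtw hr ▸ h) hn
      choose g hgC hg using fun q => (hf q).1
      simp only [← hg, strictBtw_cutClass_of_mem (hgC _)] at hf hlt
      exact ⟨g, fun q => ⟨hgC q, (hf q).2⟩, hlt⟩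
    · rintro h ⟨f, hf, hlt⟩
      exact not_relSeq_of_rat hB hbtw α _ _ (fun q => cutClass C (f q))
        (fun q => (strictBtw_cutClass_of_mem (hf q).1).2 (hf q).2)
        (fun q q' hq => (strictBtw_cutClass_of_mem (hf q).1).2 (hlt q q' hq)) h
  refine ⟨α, fun x y => by rw [hα], Quot.map (cutClass C) fun a b => (key a b).1,
    fun m => rfl, ?_, ?_⟩
  · rintro ⟨a⟩ ⟨b⟩ h
    exact Quot.sound ((key a b).2 (hr.equiv.quot_mk_eq_iff _ _ |>.1 h))
  · rintro ⟨x⟩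
    obtain ⟨a, rfl⟩ := cutClass_surjective x
    exact ⟨Quot.mk _ a, rfl⟩
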